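/- arXiv:2304.02474 — 2 statements merged into one kernel-verified Lean document; each statement's English description precedes it below -/
import Mathlib

section
/- ∑_{k=1}^∞ (9/16)^k ζ(2k)/(k(2k+1)) = ln(3π/2) − 1 − 2G/(3π), where G is Catalan's constant. -/
open Real Complex

/-- Catalan's constant `G = ∑_{n≥0} (-1)^n / (2n+1)²`. -/
noncomputable def catalanG : ℝ := ∑' n : ℕ, (-1 : ℝ) ^ n / (2 * (n : ℝ) + 1) ^ 2

open Filter Topology MeasureTheory

noncomputable def zr (k : ℕ) : ℝ := ∑' n : ℕ, 1 / ((n : ℝ) + 1) ^ (2 * (k + 1))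

lemma summable_sq_inv : Summable (fun n : ℕ => 1 / ((n : ℝ) + 1) ^ 2) := by
  have := (summable_nat_add_iff 1).2 (Real.summable_one_div_nat_pow.2 (one_lt_two))
  simpa using this

lemma summable_zr (k : ℕ) : Summable (fun n : ℕ => 1 / ((n : ℝ) + 1) ^ (2 * (k + 1))) := by
  have := (summable_nat_add_iff 1).2
    (Real.summable_one_div_nat_pow.2 (show 1 < 2 * (k + 1) by omega))
  simpa using this

lemma zr_nonneg (k : ℕ) : 0 ≤ zr k := tsum_nonneg fun n => by positivity

lemma zr_le (k : ℕ) : zr k ≤ zr 0 := by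
  refine (summable_zr k).tsum_le_tsum (fun n => ?_) (summable_zr 0)
  apply one_div_le_one_div_of_le (by positivity)
  have : (0:ℝ) ≤ n := n.cast_nonneg
  exact pow_le_pow_right₀ (by linarith) (by omega)

lemma zeta_eq_zr (k : ℕ) : riemannZeta (2 * ((k : ℂ) + 1)) = (zr k : ℂ) := by
  have h : (2 * ((k : ℂ) + 1)) = ((2 * (k + 1) : ℕ) : ℂ) := by push_cast; ring
  rw [zeta_eq_tsum_one_div_nat_add_one_cpow, zr, Complex.ofReal_tsum]
  · refine tsum_congr fun n => ?_
    rw [h, Complex.cpow_natCast]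
    push_cast
    rfl
  · rw [h, Complex.natCast_re]
    exact_mod_cast (show 1 < 2 * (k + 1) by omega)

lemma hasSum_log_sin {t : ℝ} (h0 : 0 < t) (h1 : t < 1) :
    HasSum (fun k : ℕ => zr k * (t ^ 2) ^ (k + 1) / (k + 1))
      (Real.log (π * t) - Real.log (Real.sin (π * t))) := by
  have ht : t ^ 2 < 1 := by nlinarith
  have hsin : 0 < Real.sin (π * t) :=
    Real.sin_pos_of_pos_of_lt_pi (by positivity) (by nlinarith [Real.pi_pos])
  obtain ⟨a, ha⟩ : ∃ a : ℕ × ℕ → ℝ,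
      ∀ p, a p = (t ^ 2 / ((p.1 : ℝ) + 1) ^ 2) ^ (p.2 + 1) / (p.2 + 1) := ⟨_, fun _ => rfl⟩
  have hs : Summable a := by
    have hg : Summable (fun k : ℕ => (t ^ 2) ^ (k + 1)) :=
      (summable_nat_add_iff 1).2 (summable_geometric_of_lt_one (by positivity) ht)
    refine Summable.of_nonneg_of_le (fun p => by rw [ha]; positivity) (fun p => ?_)
      (summable_sq_inv.mul_of_nonneg hg (fun n => by positivity) (fun n => by positivity))
    have hn : (0:ℝ) ≤ p.1 := p.1.cast_nonneg
    have hk : (0:ℝ) ≤ p.2 := p.2.cast_nonneg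
    have h2 : (1 / ((p.1 : ℝ) + 1) ^ 2) ^ (p.2 + 1) ≤ 1 / ((p.1 : ℝ) + 1) ^ 2 := by
      apply pow_le_of_le_one (by positivity) _ (by omega)
      rw [div_le_one (by positivity)]
      nlinarith
    calc a p ≤ (t ^ 2 / ((p.1 : ℝ) + 1) ^ 2) ^ (p.2 + 1) := by
          rw [ha]; exact div_le_self (by positivity) (by linarith)
      _ = (1 / ((p.1 : ℝ) + 1) ^ 2) ^ (p.2 + 1) * (t ^ 2) ^ (p.2 + 1) := by
          rw [← mul_pow]; congr 1; ring
      _ ≤ _ := by gcongr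
  have hlt : ∀ n : ℕ, t ^ 2 / ((n : ℝ) + 1) ^ 2 < 1 := fun n => by
    have hn : (0:ℝ) ≤ n := n.cast_nonneg
    rw [div_lt_one (by positivity)]; nlinarith
  have hrow : ∀ n : ℕ, HasSum (fun k => a (n, k)) (-Real.log (1 - t ^ 2 / ((n : ℝ) + 1) ^ 2)) := by
    intro n
    simp only [ha]
    apply Real.hasSum_pow_div_log_of_abs_lt_one
    rw [abs_of_nonneg (by positivity)]
    exact hlt n
  have hA := hs.hasSum.prod_fiberwise hrow
  have hcol : ∀ k : ℕ, HasSum (fun n => a (n, k)) (zr k * (t ^ 2) ^ (k + 1) / (k + 1)) := by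
    intro k
    have := ((summable_zr k).hasSum.mul_right ((t ^ 2) ^ (k + 1))).div_const ((k : ℝ) + 1)
    have e : (fun n => a (n, k)) = fun n : ℕ =>
        1 / ((n : ℝ) + 1) ^ (2 * (k + 1)) * (t ^ 2) ^ (k + 1) / ((k : ℝ) + 1) := by
      funext n
      rw [ha, div_pow, pow_mul ((n : ℝ) + 1)]
      ring
    rw [e]
    exact this
  have hB := HasSum.prod_fiberwise (f := fun p : ℕ × ℕ => a (p.2, p.1))
    ((Equiv.prodComm ℕ ℕ).hasSum_iff.2 hs.hasSum) hcol
  have hlim : Tendsto (fun n : ℕ => ∑ i ∈ Finset.range n, -Real.log (1 - t ^ 2 / ((i : ℝ) + 1) ^ 2))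
      atTop (𝓝 (Real.log (π * t) - Real.log (Real.sin (π * t)))) := by
    have h := Real.tendsto_euler_sin_prod t
    have h' := ((Real.continuousAt_log hsin.ne').tendsto.comp h).const_sub (Real.log (π * t))
    refine h'.congr fun n => ?_
    have hpos : ∀ i ∈ Finset.range n, (1 - t ^ 2 / ((i : ℝ) + 1) ^ 2) ≠ 0 := fun i _ => by
      have := hlt i; linarith
    simp only [Function.comp]
    rw [Real.log_mul (by positivity) (Finset.prod_ne_zero_iff.2 hpos), Real.log_prod hpos,
      Finset.sum_neg_distrib]
    ring
  rw [← tendsto_nhds_unique hA.tendsto_sum_nat hlim]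
  exact hB

noncomputable def gat : ℝ → ℝ := dslope Real.arctan 0

lemma gat_cont : Continuous gat := by
  rw [← continuousOn_univ]
  exact (continuousOn_dslope Filter.univ_mem).2
    ⟨Real.continuous_arctan.continuousOn, Real.differentiable_arctan 0⟩

lemma gat_ne {t : ℝ} (ht : t ≠ 0) : gat t = Real.arctan t / t := by
  rw [gat, dslope_of_ne _ ht, slope_def_field]; simp

lemma integral_gat : ∫ t in (0:ℝ)..1, gat t = catalanG := by
  have hi : ∀ n : ℕ, ∫ t in (0:ℝ)..1, t ^ (2 * n) / (2 * (n:ℝ) + 1) = 1 / (2 * (n:ℝ) + 1) ^ 2 := by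
    intro n
    rw [intervalIntegral.integral_div, integral_pow]
    simp
    field_simp
  have hs : Summable (fun n : ℕ => 1 / (2 * (n:ℝ) + 1) ^ 2) := by
    refine Summable.of_nonneg_of_le (fun n => by positivity) (fun n => ?_) summable_sq_inv
    have : (0:ℝ) ≤ n := n.cast_nonneg
    gcongr
    linarith
  have key := hasSum_integral_of_summable_integral_norm
    (μ := volume.restrict (Set.Ioc (0:ℝ) 1))
    (F := fun (n : ℕ) t => (-1) ^ n * (t ^ (2 * n) / (2 * (n:ℝ) + 1))) ?_ ?_
  · have e1 : ∫ t in (0:ℝ)..1, gat t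
        = ∫ t in (0:ℝ)..1, ∑' n : ℕ, (-1) ^ n * (t ^ (2 * n) / (2 * (n:ℝ) + 1)) := by
      apply intervalIntegral.integral_congr_uIoo
      intro t ht
      rw [Set.uIoo_of_le zero_le_one] at ht
      have h := (Real.hasSum_arctan (x := t)
        (by rw [Real.norm_of_nonneg ht.1.le]; exact ht.2)).div_const t
      simp only
      rw [gat_ne ht.1.ne', ← h.tsum_eq]
      refine tsum_congr fun n => ?_
      have := ht.1.ne'
      push_cast
      rw [pow_succ]
      field_simp
    rw [e1, intervalIntegral.integral_of_le zero_le_one, ← key.tsum_eq, catalanG]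
    refine tsum_congr fun n => ?_
    rw [← intervalIntegral.integral_of_le zero_le_one, intervalIntegral.integral_const_mul, hi n]
    ring
  · intro n
    apply Continuous.integrableOn_Ioc
    fun_prop
  · refine hs.congr fun n => ?_
    rw [← hi n, intervalIntegral.integral_of_le zero_le_one]
    refine setIntegral_congr_fun measurableSet_Ioc fun t ht => ?_
    have := ht.1.le
    simp only [norm_mul, norm_pow, norm_neg, norm_one, one_pow, one_mul]
    rw [Real.norm_of_nonneg (by positivity)]

lemma integral_log_tan :
    ∫ u in (0:ℝ)..(π/4), (Real.log (Real.sin u) - Real.log (Real.cos u)) = - catalanG := by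
  have hpi := Real.pi_pos
  have hcos : ∀ u ∈ Set.Icc 0 (π/4), Real.cos u ≠ 0 := fun u hu =>
    (Real.cos_pos_of_mem_Ioo ⟨by linarith [hu.1], by linarith [hu.2]⟩).ne'
  have htc : ContinuousOn Real.tan (Set.Icc 0 (π/4)) := fun u hu =>
    (Real.continuousAt_tan.2 (hcos u hu)).continuousWithinAt
  have hJ : ∀ b, HasDerivAt (fun b => ∫ t in (0:ℝ)..b, gat t) (gat b) b := fun b =>
    (gat_cont.integral_hasStrictDerivAt 0 b).hasDerivAt
  have hJc : Continuous (fun b => ∫ t in (0:ℝ)..b, gat t) :=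
    continuous_iff_continuousAt.2 fun b => (hJ b).continuousAt
  rw [intervalIntegral.integral_eq_sub_of_hasDerivAt_of_le (by positivity)
    (f := fun u => gat (Real.tan u) * (Real.tan u * Real.log (Real.tan u))
      - ∫ t in (0:ℝ)..(Real.tan u), gat t)]
  · simp [integral_gat]
  · exact ((gat_cont.comp_continuousOn htc).mul (Real.continuous_mul_log.comp_continuousOn htc)).sub
      (hJc.comp_continuousOn htc)
  · intro u hu
    have hu2 : u ∈ Set.Ioo 0 (π/2) := ⟨hu.1, by linarith [hu.2]⟩
    have hc : 0 < Real.cos u := Real.cos_pos_of_mem_Ioo ⟨by linarith [hu.1], by linarith [hu.2]⟩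
    have hsn : 0 < Real.sin u := Real.sin_pos_of_pos_of_lt_pi hu.1 (by linarith [hu.2])
    have hd : HasDerivAt (fun u => u * (Real.log (Real.sin u) - Real.log (Real.cos u))
        - ∫ t in (0:ℝ)..(Real.tan u), gat t) (Real.log (Real.sin u) - Real.log (Real.cos u)) u := by
      have h1 := (Real.hasDerivAt_sin u).log hsn.ne'
      have h2 := (Real.hasDerivAt_cos u).log hc.ne'
      have h3 := (hJ (Real.tan u)).comp u (Real.hasDerivAt_tan hc.ne')
      refine (((hasDerivAt_id u).mul (h1.sub h2)).sub h3).congr_deriv ?_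
      have ht : 0 < Real.tan u := Real.tan_pos_of_pos_of_lt_pi_div_two hu2.1 hu2.2
      rw [gat_ne ht.ne', Real.arctan_tan (by linarith [hu2.1]) hu2.2, Real.tan_eq_sin_div_cos]
      have := Real.sin_sq_add_cos_sq u
      simp only [id, Pi.sub_apply]
      field_simp
      linear_combination u * this
    refine hd.congr_of_eventuallyEq ?_
    filter_upwards [Ioo_mem_nhds hu2.1 hu2.2] with v hv
    have ht : 0 < Real.tan v := Real.tan_pos_of_pos_of_lt_pi_div_two hv.1 hv.2
    have hc : 0 < Real.cos v := Real.cos_pos_of_mem_Ioo ⟨by linarith [hv.1], by linarith [hv.2]⟩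
    have hsn : 0 < Real.sin v := Real.sin_pos_of_pos_of_lt_pi hv.1 (by linarith [hv.2])
    rw [← Real.log_div hsn.ne' hc.ne', ← Real.tan_eq_sin_div_cos, gat_ne ht.ne',
      Real.arctan_tan (by linarith [hv.1]) hv.2]
    field_simp
  · exact intervalIntegrable_log_sin.sub intervalIntegrable_log_cos

lemma integral_log_add :
    ∫ u in (0:ℝ)..(π/4), (Real.log (Real.sin u) + Real.log (Real.cos u)) = - (π / 2) * Real.log 2 := by
  have hpi := Real.pi_pos
  have h : ∫ u in (0:ℝ)..(π/4), (Real.log (Real.sin u) + Real.log (Real.cos u))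
      = ∫ u in (0:ℝ)..(π/4), (Real.log (Real.sin (2 * u)) - Real.log 2) := by
    apply intervalIntegral.integral_congr_uIoo
    intro v hv
    rw [Set.uIoo_of_le (by positivity)] at hv
    have hc : 0 < Real.cos v := Real.cos_pos_of_mem_Ioo ⟨by linarith [hv.1], by linarith [hv.2]⟩
    have hsn : 0 < Real.sin v := Real.sin_pos_of_pos_of_lt_pi hv.1 (by linarith [hv.2])
    simp only
    rw [Real.sin_two_mul, Real.log_mul (by positivity) (by positivity),
      Real.log_mul (by positivity) (by positivity)]
    ring
  have hint : IntervalIntegrable (fun u => Real.log (Real.sin (2 * u))) volume 0 (π/4) := by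
    have := (intervalIntegrable_log_sin (a := 0) (b := π/2)).comp_mul_left (c := 2)
    rw [zero_div, show π / 2 / 2 = π / 4 by ring] at this
    exact this
  rw [h, intervalIntegral.integral_sub hint intervalIntegrable_const,
    intervalIntegral.integral_comp_mul_left (fun u => Real.log (Real.sin u)) two_ne_zero,
    show 2 * (π/4) = π/2 by ring, mul_zero, integral_log_sin_zero_pi_div_two]
  simp
  ring

lemma integral_log_sin_three :
    ∫ u in (0:ℝ)..(3 * π/4), Real.log (Real.sin u) = - (3 * π / 4) * Real.log 2 + catalanG / 2 := by
  have h1 := integral_log_add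
  have h2 := integral_log_tan
  have is : ∀ a b, IntervalIntegrable (fun u => Real.log (Real.sin u)) volume a b :=
    fun a b => intervalIntegrable_log_sin
  have ic : ∀ a b, IntervalIntegrable (fun u => Real.log (Real.cos u)) volume a b :=
    fun a b => intervalIntegrable_log_cos
  rw [intervalIntegral.integral_add (is _ _) (ic _ _)] at h1
  rw [intervalIntegral.integral_sub (is _ _) (ic _ _)] at h2
  have h3 : ∫ u in (π/2)..(3 * π/4), Real.log (Real.sin u)
      = ∫ u in (0:ℝ)..(π/4), Real.log (Real.cos u) := by
    have := intervalIntegral.integral_comp_add_right (a := 0) (b := π/4)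
      (fun u => Real.log (Real.sin u)) (π/2)
    simp only [Real.sin_add_pi_div_two] at this
    rw [this]
    congr 1 <;> ring
  rw [← intervalIntegral.integral_add_adjacent_intervals (is 0 (π/2)) (is (π/2) _), h3,
    integral_log_sin_zero_pi_div_two]
  linarith

lemma hasSum_main :
    HasSum (fun k : ℕ => zr k * ((3/4:ℝ) ^ (2 * k + 3) / (2 * k + 3)) / (k + 1))
      (3 / 4 * (Real.log (3 * π / 2) - 1 - 2 * catalanG / (3 * π))) := by
  have hpi := Real.pi_pos
  have key := intervalIntegral.hasSum_integral_of_dominated_convergence (μ := volume)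
    (a := 0) (b := 3/4) (F := fun (k : ℕ) t => zr k * (t ^ 2) ^ (k + 1) / (k + 1))
    (f := fun t => Real.log (π * t) - Real.log (Real.sin (π * t)))
    (fun k _ => zr 0 * (9/16) ^ (k + 1)) ?_ ?_ ?_ ?_ ?_
  · have e1 : (fun k : ℕ => zr k * ((3/4:ℝ) ^ (2 * k + 3) / (2 * k + 3)) / (k + 1))
        = fun k : ℕ => ∫ t in (0:ℝ)..(3/4), zr k * (t ^ 2) ^ (k + 1) / (k + 1) := by
      funext k
      rw [intervalIntegral.integral_div, intervalIntegral.integral_const_mul]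
      simp only [← pow_mul]
      rw [integral_pow]
      push_cast
      rw [show 2 * (k + 1) + 1 = 2 * k + 3 by ring]
      rw [zero_pow (by omega)]
      ring
    have e2 : 3 / 4 * (Real.log (3 * π / 2) - 1 - 2 * catalanG / (3 * π))
        = ∫ t in (0:ℝ)..(3/4), (Real.log (π * t) - Real.log (Real.sin (π * t))) := by
      have il : IntervalIntegrable (fun t => Real.log (π * t)) volume 0 (3/4) := by
        have := (intervalIntegral.intervalIntegrable_log' (a := 0) (b := π * (3/4))).comp_mul_left
          (c := π)
        rw [zero_div, mul_div_cancel_left₀ _ hpi.ne'] at this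
        exact this
      have is : IntervalIntegrable (fun t => Real.log (Real.sin (π * t))) volume 0 (3/4) := by
        have := (intervalIntegrable_log_sin (a := 0) (b := π * (3/4))).comp_mul_left (c := π)
        rw [zero_div, mul_div_cancel_left₀ _ hpi.ne'] at this
        exact this
      rw [intervalIntegral.integral_sub il is,
        intervalIntegral.integral_comp_mul_left (fun u => Real.log u) hpi.ne',
        intervalIntegral.integral_comp_mul_left (fun u => Real.log (Real.sin u)) hpi.ne',
        integral_log, mul_zero, show π * (3/4) = 3 * π / 4 by ring, integral_log_sin_three,
        show 3 * π / 2 = 2 * (3 * π / 4) by ring, Real.log_mul two_ne_zero (by positivity)]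
      simp only [smul_eq_mul]
      field_simp
      ring
    rw [e1, e2]
    exact key
  · intro k
    exact (by fun_prop : Continuous _).aestronglyMeasurable
  · intro k
    refine .of_forall fun t ht => ?_
    rw [Set.uIoc_of_le (by norm_num)] at ht
    have h0 := zr_nonneg k
    rw [Real.norm_of_nonneg (by positivity)]
    refine (div_le_self (by positivity) (by linarith [(Nat.cast_nonneg k : (0:ℝ) ≤ k)])).trans ?_
    have : t ^ 2 ≤ 9/16 := by nlinarith [ht.1, ht.2]
    have := zr_le k
    have := zr_nonneg 0
    gcongr
  · refine .of_forall fun t ht => ?_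
    exact ((summable_nat_add_iff 1).2
      (summable_geometric_of_lt_one (by norm_num) (by norm_num : (9/16:ℝ) < 1))).mul_left _
  · exact intervalIntegrable_const
  · refine .of_forall fun t ht => ?_
    rw [Set.uIoc_of_le (by norm_num)] at ht
    exact hasSum_log_sin ht.1 (by linarith [ht.2])

theorem stmt14 :
    ∑' k : ℕ, ((9 : ℂ) / 16) ^ (k + 1) * riemannZeta (2 * ((k : ℂ) + 1))
        / (((k : ℂ) + 1) * (2 * ((k : ℂ) + 1) + 1))
      = Real.log (3 * π / 2) - 1 - 2 * (catalanG : ℂ) / (3 * π) := by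
  have h := hasSum_main.mul_left (4/3)
  have h2 := Complex.hasSum_ofReal.2 h
  have h3 : (Real.log (3 * π / 2) - 1 - 2 * (catalanG : ℂ) / (3 * π) : ℂ)
      = ((4/3 * (3 / 4 * (Real.log (3 * π / 2) - 1 - 2 * catalanG / (3 * π))) : ℝ) : ℂ) := by
    push_cast; ring
  rw [h3, ← h2.tsum_eq]
  refine tsum_congr fun k => ?_
  rw [zeta_eq_zr]
  have e : ((9:ℂ)/16) ^ (k+1) = 4/3 * (3/4) ^ (2 * k + 3) := by
    rw [show 2 * k + 3 = 2 * (k + 1) + 1 by ring, pow_succ _ (2 * (k + 1)), pow_mul]; norm_num; ring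
  rw [e]
  push_cast
  rw [show (2 * ((k:ℂ) + 1) + 1) = 2 * k + 3 by ring]
  rw [div_eq_mul_inv, mul_inv]
  ring
end

section
/- ∑_{k=1}^∞ ζ(2k)/(16^k k(k+1)) = ln(π/2) − 1/2 − 35ζ(3)/(4π²) + 4G/π, where G is Catalan's constant. -/
open Real Complex

open Filter Topology MeasureTheory

noncomputable def zz (k : ℕ) : ℝ := ∑' n : ℕ, 1 / ((n : ℝ) + 1) ^ (2 * k + 2)

lemma zz_nonneg (k : ℕ) : 0 ≤ zz k := tsum_nonneg fun n => by positivity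

lemma zz_zeta (k : ℕ) : riemannZeta (2 * ((k : ℂ) + 1)) = (zz k : ℂ) := by
  have h := zeta_eq_tsum_one_div_nat_add_one_cpow (s := 2 * ((k : ℂ) + 1)) (by
    simp; have : (0:ℝ) ≤ k := Nat.cast_nonneg k
    linarith)
  rw [h, zz, Complex.ofReal_tsum]
  refine tsum_congr fun n => ?_
  have : (2 * ((k : ℂ) + 1)) = ((2 * k + 2 : ℕ) : ℂ) := by push_cast; ring
  rw [this, Complex.cpow_natCast]
  push_cast; rfl

lemma hb_aux (t : ℝ) (h0 : 0 < t) (h1 : t ≤ 1 / 4) (n : ℕ) :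
    0 ≤ t ^ 2 / ((n : ℝ) + 1) ^ 2 ∧ t ^ 2 / ((n : ℝ) + 1) ^ 2 < 1 := by
  refine ⟨by positivity, ?_⟩
  rw [div_lt_one (by positivity)]
  have : (0:ℝ) ≤ n := Nat.cast_nonneg n
  nlinarith

lemma hasSum_logs (t : ℝ) (h0 : 0 < t) (h1 : t ≤ 1 / 4) :
    HasSum (fun n : ℕ => -Real.log (1 - t ^ 2 / ((n : ℝ) + 1) ^ 2))
      (Real.log (π * t) - Real.log (Real.sin (π * t))) := by
  have hb := hb_aux t h0 h1
  have hs : 0 < Real.sin (π * t) := by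
    apply Real.sin_pos_of_pos_of_lt_pi
    · positivity
    · nlinarith [Real.pi_pos]
  have hp : 0 < π * t := by positivity
  rw [hasSum_iff_tendsto_nat_of_nonneg]
  · have h := Real.tendsto_euler_sin_prod t
    have h2 := ((Real.continuousAt_log hs.ne').tendsto.comp h)
    have h3 := (tendsto_const_nhds (x := Real.log (π * t))).sub h2
    refine h3.congr fun n => ?_
    simp only [Function.comp]
    rw [Real.log_mul hp.ne' (Finset.prod_ne_zero_iff.2 fun i _ => by have := hb i; linarith),
      Real.log_prod (fun i _ => by have := hb i; linarith)]
    simp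
  · intro n
    have := Real.log_nonpos (x := 1 - t ^ 2 / ((n : ℝ) + 1) ^ 2) (by linarith [(hb n).2])
      (by linarith [(hb n).1])
    linarith

lemma hasSum_F (t : ℝ) (h0 : 0 < t) (h1 : t ≤ 1 / 4) :
    HasSum (fun k : ℕ => zz k * t ^ (2 * k + 2) / ((k : ℝ) + 1))
      (Real.log (π * t) - Real.log (Real.sin (π * t))) := by
  have hb := hb_aux t h0 h1
  let f : ℕ × ℕ → ℝ := fun p => (t ^ 2 / ((p.1 : ℝ) + 1) ^ 2) ^ (p.2 + 1) / ((p.2 : ℝ) + 1)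
  have hrow : ∀ n : ℕ, HasSum (fun k => f (n, k)) (-Real.log (1 - t ^ 2 / ((n : ℝ) + 1) ^ 2)) :=
    fun n => by
      have hab : |t ^ 2 / ((n : ℝ) + 1) ^ 2| < 1 := by
        rw [abs_of_nonneg (hb n).1]; exact (hb n).2
      have h := Real.hasSum_pow_div_log_of_abs_lt_one hab
      simpa only [f] using h
  have hl := hasSum_logs t h0 h1
  have hf : Summable f := by
    rw [summable_prod_of_nonneg]
    · refine ⟨fun n => (hrow n).summable, ?_⟩
      simp_rw [fun n => (hrow n).tsum_eq]
      exact hl.summable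
    · intro p; simp only [f, Pi.zero_apply]; positivity
  have hval : ∑' p, f p = Real.log (π * t) - Real.log (Real.sin (π * t)) :=
    (hf.hasSum.prod_fiberwise hrow).unique hl
  have h2 : HasSum (fun p : ℕ × ℕ => f p.swap) (Real.log (π * t) - Real.log (Real.sin (π * t))) := by
    rw [← hval]
    exact (Equiv.prodComm ℕ ℕ).hasSum_iff.2 hf.hasSum
  refine h2.prod_fiberwise fun k => ?_
  have hs : Summable fun n : ℕ => 1 / ((n : ℝ) + 1) ^ (2 * k + 2) := by
    have := (summable_nat_add_iff 1).2 (Real.summable_one_div_nat_pow (p := 2 * k + 2).2 (by omega))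
    simpa using this
  have h3 := (hs.hasSum.mul_right (t ^ (2 * k + 2))).div_const ((k : ℝ) + 1)
  refine h3.congr_fun ?_
  intro n
  simp only [f, Prod.swap]
  rw [div_pow, ← pow_mul, ← pow_mul]
  ring_nf

lemma series_eq_integral :
    HasSum (fun k : ℕ => zz k / (16 ^ (k + 1) * ((k : ℝ) + 1) * ((k : ℝ) + 2)))
      (32 * ∫ t in (0:ℝ)..(1/4), t * (Real.log (π * t) - Real.log (Real.sin (π * t)))) := by
  have h := intervalIntegral.hasSum_integral_of_dominated_convergence (μ := volume)
    (a := 0) (b := 1/4)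
    (F := fun (k : ℕ) (t : ℝ) => t * (zz k * t ^ (2 * k + 2) / ((k : ℝ) + 1)))
    (f := fun t => t * (Real.log (π * t) - Real.log (Real.sin (π * t))))
    (fun k _ => zz k * (1/4) ^ (2 * k + 2) / ((k : ℝ) + 1))
    (fun k => by
      apply Continuous.aestronglyMeasurable
      fun_prop)
    (fun k => Eventually.of_forall fun t ht => by
      rw [Set.uIoc_of_le (by norm_num)] at ht
      have hz := zz_nonneg k
      have ht0 := ht.1
      have ht1 := ht.2
      rw [Real.norm_of_nonneg (by positivity)]
      have : zz k * t ^ (2 * k + 2) / ((k : ℝ) + 1) ≤ zz k * (1/4) ^ (2 * k + 2) / ((k : ℝ) + 1) := by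
        gcongr
      have h0 : 0 ≤ zz k * t ^ (2 * k + 2) / ((k : ℝ) + 1) := by positivity
      nlinarith)
    (Eventually.of_forall fun t ht => (hasSum_F (1/4) (by norm_num) (by norm_num)).summable)
    intervalIntegrable_const
    (Eventually.of_forall fun t ht => by
      rw [Set.uIoc_of_le (by norm_num)] at ht
      exact (hasSum_F t ht.1 ht.2).mul_left t)
  refine (h.mul_left 32).congr_fun ?_
  intro k
  have e : ∀ t : ℝ, t * (zz k * t ^ (2 * k + 2) / ((k : ℝ) + 1)) =
      (zz k / ((k : ℝ) + 1)) * t ^ (2 * k + 3) := fun t => by ring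
  simp_rw [e]
  rw [intervalIntegral.integral_const_mul, integral_pow]
  have : (1 / 4 : ℝ) ^ (2 * k + 3 + 1) = 1 / (16 * 16 ^ (k + 1)) := by
    rw [show 2 * k + 3 + 1 = 2 * (k + 2) by ring, pow_mul]
    rw [show (1 / 4 : ℝ) ^ 2 = 1 / 16 by norm_num, one_div_pow]
    ring
  rw [this]
  push_cast
  have h2 : (k : ℝ) + 2 ≠ 0 := by positivity
  have h3 : 2 * (k : ℝ) + 3 + 1 ≠ 0 := by positivity
  field_simp
  ring_nf

lemma int_tlog : ∫ t in (0:ℝ)..(1/4), t * Real.log (π * t) = Real.log (π / 4) / 32 - 1 / 64 := by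
  have hpi := Real.pi_pos
  have hc : Continuous fun t : ℝ => t * Real.log (π * t) := by
    have := (Real.continuous_mul_log.comp (continuous_const.mul continuous_id : Continuous fun t : ℝ => π * t)).div_const π
    refine this.congr fun t => ?_
    simp; field_simp
  have h := intervalIntegral.integral_eq_sub_of_hasDerivAt_of_le (a := 0) (b := 1/4) (by norm_num)
    (f := fun t : ℝ => t / 2 * (t * Real.log (π * t)) - t ^ 2 / 4)
    (f' := fun t => t * Real.log (π * t)) (by fun_prop)
    (fun x hx => by
      have hx0 : x ≠ 0 := hx.1.ne'
      have h1 := ((hasDerivAt_id x).const_mul π).log (by simp [hx0, hpi.ne'])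
      have h2 := (((hasDerivAt_id x).div_const 2).mul ((hasDerivAt_id x).mul h1)).sub
        (((hasDerivAt_id x).pow 2).div_const 4)
      refine h2.congr_deriv ?_
      simp
      field_simp
      ring)
    (hc.intervalIntegrable _ _)
  rw [h]
  rw [show π * (1/4) = π / 4 by ring]
  norm_num
  ring

lemma hasSum_cosr (r θ : ℝ) (h0 : 0 ≤ r) (h1 : r < 1) :
    HasSum (fun n : ℕ => r ^ n * Real.cos (n * θ) / n)
      (-(1 / 2) * Real.log (1 - 2 * r * Real.cos θ + r ^ 2)) := by
  have hz : ‖(r : ℂ) * Complex.exp (θ * Complex.I)‖ < 1 := by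
    rw [norm_mul, Complex.norm_exp_ofReal_mul_I, Complex.norm_real, Real.norm_of_nonneg h0]
    linarith
  have h := Complex.hasSum_re (Complex.hasSum_taylorSeries_neg_log hz)
  convert h using 1
  · funext n
    rw [mul_pow, ← Complex.exp_nat_mul, Complex.div_natCast_re, ← Complex.ofReal_pow,
      Complex.re_ofReal_mul, ← mul_assoc]
    congr 2
    rw [show (n : ℂ) * θ = ((n * θ : ℝ) : ℂ) by push_cast; rfl, Complex.exp_ofReal_mul_I_re]
  · rw [Complex.neg_re, Complex.log_re]
    have : 1 - 2 * r * Real.cos θ + r ^ 2 = ‖1 - (r : ℂ) * Complex.exp (θ * Complex.I)‖ ^ 2 := by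
      rw [← Complex.normSq_eq_norm_sq, Complex.normSq_apply]
      simp only [Complex.sub_re, Complex.sub_im, Complex.re_ofReal_mul, Complex.im_ofReal_mul,
        Complex.exp_ofReal_mul_I_re, Complex.exp_ofReal_mul_I_im, Complex.one_re, Complex.one_im]
      nlinarith [Real.sin_sq_add_cos_sq θ]
    rw [this, Real.log_pow]
    push_cast; ring

noncomputable def dd (n : ℕ) : ℝ :=
  (∫ t in (0:ℝ)..(1/4), t * Real.cos (n * (2 * π * t))) / n

lemma dd_eq (n : ℕ) : dd n = Real.sin (n * (π / 2)) / (n : ℝ) ^ 2 * (1 / (8 * π)) +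
    Real.cos (n * (π / 2)) / (n : ℝ) ^ 3 * (1 / (4 * π ^ 2)) - 1 / (n : ℝ) ^ 3 * (1 / (4 * π ^ 2)) := by
  rcases Nat.eq_zero_or_pos n with rfl | hn
  · simp [dd]
  have hn0 : (n : ℝ) ≠ 0 := by positivity
  have hpi := Real.pi_ne_zero
  have h := intervalIntegral.integral_eq_sub_of_hasDerivAt (a := 0) (b := 1/4)
    (f := fun t : ℝ => t * Real.sin (n * (2 * π * t)) / (2 * π * n) +
      Real.cos (n * (2 * π * t)) / (2 * π * n) ^ 2)
    (f' := fun t : ℝ => t * Real.cos (n * (2 * π * t)))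
    (fun x _ => by
      have h0 := ((hasDerivAt_id x).const_mul (2 * π)).const_mul (n : ℝ)
      have h2 := (((hasDerivAt_id x).mul h0.sin).div_const (2 * π * n)).add
        (h0.cos.div_const ((2 * π * n) ^ 2))
      refine h2.congr_deriv ?_
      simp
      field_simp
      ring)
    (by apply Continuous.intervalIntegrable; fun_prop)
  rw [dd, h]
  rw [show (n : ℝ) * (2 * π * (1 / 4)) = n * (π / 2) by ring]
  simp
  field_simp
  ring

lemma dd_bound (n : ℕ) : |dd n| ≤ 1 / (n : ℝ) ^ 2 := by
  rcases Nat.eq_zero_or_pos n with rfl | hn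
  · simp [dd]
  have hn0 : (0 : ℝ) < n := by positivity
  rw [dd, abs_div, abs_of_pos hn0, div_le_div_iff₀ hn0 (by positivity)]
  -- bound on the integral through the closed form
  have hd := dd_eq n
  have e : (∫ t in (0:ℝ)..(1/4), t * Real.cos (n * (2 * π * t))) = dd n * n := by
    rw [dd, div_mul_cancel₀ _ hn0.ne']
  rw [e, hd]
  have hn1 : (1 : ℝ) ≤ n := by exact_mod_cast hn
  have hpi := Real.pi_gt_three
  have hs := Real.abs_sin_le_one (n * (π / 2))
  have hc := Real.abs_cos_le_one (n * (π / 2))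
  set s := Real.sin (n * (π / 2))
  set c := Real.cos (n * (π / 2))
  have e2 : (s / (n : ℝ) ^ 2 * (1 / (8 * π)) + c / (n : ℝ) ^ 3 * (1 / (4 * π ^ 2)) -
      1 / (n : ℝ) ^ 3 * (1 / (4 * π ^ 2))) * n =
      (s * (1 / (8 * π)) + (c - 1) * (1 / (4 * π ^ 2)) * (1 / n)) / n := by
    field_simp
    ring
  rw [e2, abs_div, abs_of_pos hn0, sq (n : ℝ), ← mul_assoc, div_mul_cancel₀ _ hn0.ne', one_mul]
  refine mul_le_of_le_one_left hn0.le ?_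
  have b1 : 1 / (8 * π) ≤ 1 / 24 := one_div_le_one_div_of_le (by norm_num) (by linarith)
  have b2 : 1 / (4 * π ^ 2) ≤ 1 / 36 := one_div_le_one_div_of_le (by norm_num) (by nlinarith)
  have b3 : 1 / (n : ℝ) ≤ 1 := by rw [div_le_one hn0]; exact hn1
  have p1 : 0 < 1 / (8 * π) := by positivity
  have p2 : 0 < 1 / (4 * π ^ 2) := by positivity
  have p3 : 0 < 1 / (n : ℝ) := by positivity
  have b4 : 1 / (4 * π ^ 2) * (1 / n) ≤ 1 / 36 := by nlinarith
  have hX : |s * (1 / (8 * π))| ≤ 1 / 24 := by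
    rw [abs_mul, abs_of_pos p1]; nlinarith [abs_nonneg s]
  have hc2 : |c - 1| ≤ 2 := by
    rw [abs_le] at hc ⊢; constructor <;> linarith
  have hY : |(c - 1) * (1 / (4 * π ^ 2)) * (1 / n)| ≤ 2 / 36 := by
    rw [mul_assoc, abs_mul, abs_of_pos (mul_pos p2 p3)]
    nlinarith [abs_nonneg (c - 1), mul_pos p2 p3]
  calc _ ≤ _ := abs_add_le _ _
    _ ≤ 1 / 24 + 2 / 36 := add_le_add hX hY
    _ ≤ 1 := by norm_num

noncomputable def gg (r t : ℝ) : ℝ :=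
  t * (-(1 / 2) * Real.log (1 - 2 * r * Real.cos (2 * π * t) + r ^ 2))

lemma gg_sum (r : ℝ) (h0 : 0 ≤ r) (h1 : r < 1) :
    HasSum (fun n => r ^ n * dd n) (∫ t in (0:ℝ)..(1/4), gg r t) := by
  have h := intervalIntegral.hasSum_integral_of_dominated_convergence (μ := volume)
    (a := 0) (b := 1/4)
    (F := fun (n : ℕ) (t : ℝ) => t * (r ^ n * Real.cos (n * (2 * π * t)) / n))
    (f := fun t => gg r t)
    (fun n _ => r ^ n)
    (fun k => by
      apply Continuous.aestronglyMeasurable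
      fun_prop)
    (fun n => Eventually.of_forall fun t ht => by
      rw [Set.uIoc_of_le (by norm_num)] at ht
      have ht0 := ht.1
      have ht1 := ht.2
      rcases Nat.eq_zero_or_pos n with rfl | hn
      · simp
      have hn1 : (1 : ℝ) ≤ n := by exact_mod_cast hn
      have hr : 0 ≤ r ^ n := by positivity
      rw [Real.norm_eq_abs, abs_mul, abs_div, abs_mul, abs_of_pos ht0, abs_of_nonneg hr,
        Nat.abs_cast]
      have hc := Real.abs_cos_le_one (n * (2 * π * t))
      have h3 : r ^ n * |Real.cos (n * (2 * π * t))| / n ≤ r ^ n := by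
        rw [div_le_iff₀ (by linarith)]
        nlinarith [abs_nonneg (Real.cos (n * (2 * π * t)))]
      have h4 : 0 ≤ r ^ n * |Real.cos (n * (2 * π * t))| / n := by positivity
      nlinarith)
    (Eventually.of_forall fun t ht => summable_geometric_of_lt_one h0 h1)
    intervalIntegrable_const
    (Eventually.of_forall fun t ht => (hasSum_cosr r (2 * π * t) h0 h1).mul_left t)
  refine h.congr_fun ?_
  intro n
  rw [dd, mul_div_assoc', ← intervalIntegral.integral_const_mul, ← intervalIntegral.integral_div]
  congr 1
  funext t
  ring

lemma gg_bound (r t : ℝ) (h0 : 0 ≤ r) (h1 : r ≤ 1) (ht0 : 0 < t) (ht1 : t ≤ 1 / 4) :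
    0 < 1 - 2 * r * Real.cos (2 * π * t) + r ^ 2 ∧ |gg r t| ≤ 1 := by
  have hpi := Real.pi_pos
  have hs := Real.mul_le_sin (x := 2 * π * t) (by positivity) (by nlinarith)
  rw [show 2 / π * (2 * π * t) = 4 * t by field_simp; ring] at hs
  have hc : 0 ≤ Real.cos (2 * π * t) :=
    Real.cos_nonneg_of_mem_Icc ⟨by nlinarith [mul_pos hpi ht0], by nlinarith⟩
  have hsc := Real.sin_sq_add_cos_sq (2 * π * t)
  have hD : (4 * t) ^ 2 ≤ 1 - 2 * r * Real.cos (2 * π * t) + r ^ 2 := by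
    nlinarith [sq_nonneg (r - Real.cos (2 * π * t))]
  have hD2 : 1 - 2 * r * Real.cos (2 * π * t) + r ^ 2 ≤ 2 := by nlinarith [mul_nonneg h0 hc]
  have hp : 0 < (4 * t) ^ 2 := by positivity
  unfold gg
  set D := 1 - 2 * r * Real.cos (2 * π * t) + r ^ 2
  have hDp : 0 < D := by linarith
  refine ⟨hDp, ?_⟩
  have l1 : Real.log D ≤ 1 := by linarith [Real.log_le_sub_one_of_pos hDp]
  have l2 : 2 * (1 - (4 * t)⁻¹) ≤ Real.log D := by
    have a := Real.log_le_log hp hD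
    rw [Real.log_pow] at a
    have b := Real.one_sub_inv_le_log_of_pos (x := 4 * t) (by positivity)
    push_cast at a
    linarith
  have l3 : t * (2 * (1 - (4 * t)⁻¹)) ≤ t * Real.log D := mul_le_mul_of_nonneg_left l2 ht0.le
  have l4 : t * (2 * (1 - (4 * t)⁻¹)) = 2 * t - 1 / 2 := by field_simp; ring
  have l5 : t * Real.log D ≤ t * 1 := mul_le_mul_of_nonneg_left l1 ht0.le
  rw [abs_le]
  constructor <;> nlinarith

lemma gg_int : ∫ t in (0:ℝ)..(1/4), gg 1 t = ∑' n, dd n := by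
  have hsum : Summable fun n : ℕ => 1 / (n : ℝ) ^ 2 := Real.summable_one_div_nat_pow.2 (by norm_num)
  have hmem : ∀ᶠ r : ℝ in 𝓝[<] 1, 0 ≤ r ∧ r < 1 := by
    have h1 : ∀ᶠ r : ℝ in 𝓝[<] 1, 0 < r :=
      nhdsWithin_le_nhds (lt_mem_nhds (by norm_num))
    filter_upwards [h1, self_mem_nhdsWithin] with r hr hr'
    exact ⟨hr.le, hr'⟩
  have t1 : Tendsto (fun r : ℝ => ∑' n, r ^ n * dd n) (𝓝[<] 1) (𝓝 (∑' n, dd n)) := by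
    refine tendsto_tsum_of_dominated_convergence hsum (fun n => ?_) ?_
    · have : Tendsto (fun r : ℝ => r ^ n * dd n) (𝓝 1) (𝓝 (1 ^ n * dd n)) :=
        Continuous.tendsto (by fun_prop) 1
      simpa using this.mono_left nhdsWithin_le_nhds
    · filter_upwards [hmem] with r hr n
      rw [norm_mul, norm_pow, Real.norm_of_nonneg hr.1, Real.norm_eq_abs]
      calc _ ≤ 1 * |dd n| := by
            gcongr
            exact pow_le_one₀ hr.1 hr.2.le
        _ ≤ _ := by rw [one_mul]; exact dd_bound n
  have t2 : Tendsto (fun r : ℝ => ∫ t in (0:ℝ)..(1/4), gg r t) (𝓝[<] 1)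
      (𝓝 (∫ t in (0:ℝ)..(1/4), gg 1 t)) := by
    refine intervalIntegral.tendsto_integral_filter_of_dominated_convergence (fun _ => 1) ?_ ?_
      intervalIntegrable_const ?_
    · refine Eventually.of_forall fun r => Measurable.aestronglyMeasurable ?_
      unfold gg
      fun_prop
    · filter_upwards [hmem] with r hr
      refine Eventually.of_forall fun t ht => ?_
      rw [Set.uIoc_of_le (by norm_num)] at ht
      exact (gg_bound r t hr.1 hr.2.le ht.1 ht.2).2
    · refine Eventually.of_forall fun t ht => ?_
      rw [Set.uIoc_of_le (by norm_num)] at ht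
      have hp := (gg_bound 1 t (by norm_num) le_rfl ht.1 ht.2).1
      refine Tendsto.mono_left ?_ nhdsWithin_le_nhds
      unfold gg
      refine Tendsto.const_mul _ (Tendsto.const_mul _ ?_)
      refine Tendsto.log ?_ hp.ne'
      exact Continuous.tendsto (f := fun r : ℝ => 1 - 2 * r * Real.cos (2 * π * t) + r ^ 2)
        (by fun_prop) 1
  refine tendsto_nhds_unique t2 (t1.congr' ?_)
  filter_upwards [hmem] with r hr
  exact (gg_sum r hr.1 hr.2).tsum_eq

lemma gg_one (t : ℝ) (ht0 : 0 < t) (ht1 : t ≤ 1 / 4) :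
    gg 1 t = -(t * Real.log 2) - t * Real.log (Real.sin (π * t)) := by
  have hs : 0 < Real.sin (π * t) := by
    apply Real.sin_pos_of_pos_of_lt_pi
    · positivity
    · nlinarith [Real.pi_pos]
  unfold gg
  have : 1 - 2 * 1 * Real.cos (2 * π * t) + 1 ^ 2 = (2 * Real.sin (π * t)) ^ 2 := by
    rw [show 2 * π * t = 2 * (π * t) by ring, Real.cos_two_mul]
    nlinarith [Real.sin_sq_add_cos_sq (π * t)]
  rw [this, Real.log_pow, Real.log_mul (by norm_num) hs.ne']
  push_cast; ring

lemma main_int :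
    32 * ∫ t in (0:ℝ)..(1/4), t * (Real.log (π * t) - Real.log (Real.sin (π * t))) =
      Real.log (π / 2) - 1 / 2 + 32 * ∑' n, dd n := by
  have i1 : IntervalIntegrable (fun t : ℝ => t * Real.log (π * t)) volume 0 (1/4) := by
    have hc : Continuous fun t : ℝ => t * Real.log (π * t) := by
      have := (Real.continuous_mul_log.comp
        (continuous_const.mul continuous_id : Continuous fun t : ℝ => π * t)).div_const π
      refine this.congr fun t => ?_
      simp; field_simp
    exact hc.intervalIntegrable _ _
  have i2 : IntervalIntegrable (gg 1) volume 0 (1/4) := by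
    refine IntervalIntegrable.mono_fun' (g := fun _ => (1:ℝ)) intervalIntegrable_const ?_ ?_
    · refine Measurable.aestronglyMeasurable ?_
      unfold gg
      fun_prop
    · refine (ae_restrict_iff' measurableSet_uIoc).2 (Eventually.of_forall fun t ht => ?_)
      rw [Set.uIoc_of_le (by norm_num)] at ht
      exact (gg_bound 1 t (by norm_num) le_rfl ht.1 ht.2).2
  have i3 : IntervalIntegrable (fun t : ℝ => t * Real.log 2) volume 0 (1/4) := by
    apply Continuous.intervalIntegrable; fun_prop
  have e : ∫ t in (0:ℝ)..(1/4), t * (Real.log (π * t) - Real.log (Real.sin (π * t))) =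
      ∫ t in (0:ℝ)..(1/4), (t * Real.log (π * t) + gg 1 t + t * Real.log 2) := by
    refine intervalIntegral.integral_congr_ae (Eventually.of_forall fun t ht => ?_)
    rw [Set.uIoc_of_le (by norm_num)] at ht
    rw [gg_one t ht.1 ht.2]; ring
  rw [e, intervalIntegral.integral_add (i1.add i2) i3, intervalIntegral.integral_add i1 i2,
    int_tlog, gg_int, intervalIntegral.integral_mul_const, integral_id]
  have : Real.log (π / 2) = Real.log (π / 4) + Real.log 2 := by
    rw [← Real.log_mul (by positivity) (by norm_num)]; congr 1; ring
  rw [this]; ring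

noncomputable def z3 : ℝ := ∑' n : ℕ, 1 / (n : ℝ) ^ 3

lemma z3_zeta : riemannZeta 3 = (z3 : ℂ) := by
  have h := zeta_nat_eq_tsum_of_gt_one (k := 3) (by norm_num)
  rw [z3, Complex.ofReal_tsum]
  push_cast at h ⊢
  exact h

lemma z3_sum : HasSum (fun n : ℕ => 1 / (n : ℝ) ^ 3) z3 :=
  (Real.summable_one_div_nat_pow.2 (by norm_num)).hasSum

lemma z3_even : HasSum (fun m : ℕ => 1 / ((2 * m : ℕ) : ℝ) ^ 3) (z3 / 8) := by
  refine (z3_sum.div_const 8).congr_fun ?_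
  intro m; push_cast; rw [mul_pow, div_div]; congr 1; ring

lemma z3_odd : HasSum (fun m : ℕ => 1 / ((2 * m + 1 : ℕ) : ℝ) ^ 3) (7 / 8 * z3) := by
  have hs : Summable (fun m : ℕ => 1 / ((2 * m + 1 : ℕ) : ℝ) ^ 3) :=
    z3_sum.summable.comp_injective (i := fun m : ℕ => 2 * m + 1) (fun a b h => by simpa using h)
  have h := (z3_even.even_add_odd (f := fun n : ℕ => 1 / (n : ℝ) ^ 3) hs.hasSum).unique z3_sum
  have : ∑' m : ℕ, 1 / ((2 * m + 1 : ℕ) : ℝ) ^ 3 = 7 / 8 * z3 := by linarith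
  rw [← this]; exact hs.hasSum

lemma alt_sum : HasSum (fun n : ℕ => (-1 : ℝ) ^ n / (n : ℝ) ^ 3) (-(3 / 4) * z3) := by
  have := HasSum.even_add_odd (f := fun n : ℕ => (-1 : ℝ) ^ n / (n : ℝ) ^ 3)
    (m := z3 / 8) (m' := -(7 / 8 * z3))
    (by simpa [pow_mul] using z3_even) (by simpa [pow_succ, pow_mul, neg_div] using z3_odd.neg)
  convert this using 1; ring

lemma cos_sum : HasSum (fun n : ℕ => Real.cos (n * (π / 2)) / (n : ℝ) ^ 3) (-(3 / 32) * z3) := by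
  have := HasSum.even_add_odd (f := fun n : ℕ => Real.cos (n * (π / 2)) / (n : ℝ) ^ 3)
    (m := -(3 / 32) * z3) (m' := 0)
    (by
      have h8 : -(3 / 32) * z3 = -(3 / 4) * z3 / 8 := by ring
      rw [h8]
      refine (alt_sum.div_const 8).congr_fun ?_
      · intro m
        push_cast
        rw [show 2 * (m : ℝ) * (π / 2) = m * π by ring, Real.cos_nat_mul_pi, mul_pow, div_div]
        congr 1; ring)
    (by
      convert hasSum_zero using 1
      funext m
      push_cast
      rw [show (2 * (m : ℝ) + 1) * (π / 2) = m * π + π / 2 by ring, Real.cos_add_pi_div_two,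
        Real.sin_nat_mul_pi]
      simp)
  simpa using this

lemma sin_sum : HasSum (fun n : ℕ => Real.sin (n * (π / 2)) / (n : ℝ) ^ 2) catalanG := by
  have hs : Summable (fun n : ℕ => (-1 : ℝ) ^ n / (2 * (n : ℝ) + 1) ^ 2) := by
    have h2 : Summable fun n : ℕ => 1 / (n : ℝ) ^ 2 := Real.summable_one_div_nat_pow.2 (by norm_num)
    have h3 := h2.comp_injective (i := fun m : ℕ => 2 * m + 1) (fun a b h => by simpa using h)
    refine Summable.of_norm (h3.congr fun n => ?_)
    simp
  have := HasSum.even_add_odd (f := fun n : ℕ => Real.sin (n * (π / 2)) / (n : ℝ) ^ 2)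
    (m := 0) (m' := catalanG)
    (by
      convert hasSum_zero using 1
      funext m
      push_cast
      rw [show 2 * (m : ℝ) * (π / 2) = m * π by ring, Real.sin_nat_mul_pi]
      simp)
    (by
      have hG := hs.hasSum
      rw [← catalanG] at hG
      refine hG.congr_fun ?_
      intro m
      push_cast
      rw [show (2 * (m : ℝ) + 1) * (π / 2) = m * π + π / 2 by ring, Real.sin_add_pi_div_two,
        Real.cos_nat_mul_pi])
  simpa using this

lemma dd_sum : ∑' n, dd n = catalanG / (8 * π) - 35 / 32 * z3 / (4 * π ^ 2) := by
  have h := ((sin_sum.mul_right (1 / (8 * π))).add (cos_sum.mul_right (1 / (4 * π ^ 2)))).sub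
    (z3_sum.mul_right (1 / (4 * π ^ 2)))
  rw [tsum_congr dd_eq, h.tsum_eq]
  ring

theorem stmt15 :
    ∑' k : ℕ, riemannZeta (2 * ((k : ℂ) + 1))
        / ((16 : ℂ) ^ (k + 1) * ((k : ℂ) + 1) * ((k : ℂ) + 2))
      = Real.log (π / 2) - 1 / 2 - 35 * riemannZeta 3 / (4 * (π : ℂ) ^ 2)
        + 4 * (catalanG : ℂ) / π := by
  have h := series_eq_integral.tsum_eq
  rw [main_int, dd_sum] at h
  have h2 : ∑' k : ℕ, zz k / (16 ^ (k + 1) * ((k : ℝ) + 1) * ((k : ℝ) + 2)) =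
      Real.log (π / 2) - 1 / 2 - 35 * z3 / (4 * π ^ 2) + 4 * catalanG / π := by
    rw [h]
    have := Real.pi_ne_zero
    field_simp
    ring
  rw [z3_zeta]
  have h3 := congrArg (fun x : ℝ => (x : ℂ)) h2
  simp only [Complex.ofReal_tsum] at h3
  push_cast at h3
  refine Eq.trans ?_ h3
  refine tsum_congr fun k => ?_
  rw [zz_zeta]
end
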